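/- Let b : ℝ → ℝ and σ : ℝ → [0,∞) satisfy Assumption (A): there exist m ∈ ℕ ∪ {0}, points −∞ = ξ₀ < ξ₁ < … < ξ_m < ξ_{m+1} = ∞, and constants L_b, K_b, L_σ, γ, η ∈ (0,∞) such that (A1) b satisfies condition (A1) on each open interval (ξ_k, ξ_{k+1}) with these constants; (A2) σ is globally Lipschitz with constant L_σ; (A3) σ(ξ_k) ≠ 0 for all k ∈ {1,…,m}. Define α_k = (1/2)·σ(ξ_k)⁻²·(b(ξ_k−) − b(ξ_k+)) (the one-sided limits exist and are finite), choose c₀ > 0 with 6·c₀·|α_k| < 1 for all k and (if m ≥ 2) c₀ < (1/2)·min_k (ξ_{k+1} − ξ_k), and set G(x) = x + Σ_{k=1}^m α_k·φ((x−ξ_k)/c₀)·(x−ξ_k)·|x−ξ_k| with φ(u) = (1+u)³(1−u)³ for |u| ≤ 1 and 0 otherwise. Then there exist constants L_b̃, K_b̃, L_σ̃, γ̃, η̃ ∈ (0,∞), a continuous function b̃ : ℝ → ℝ with b̃(G(x)) = b(x)·G′(x) + (1/2)·σ(x)²·G″(x) for every x ∉ {ξ₁,…,ξ_m}, and, setting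 σ̃ = (σ·G′)∘G⁻¹, the following hold: (i) b̃ is absolutely continuous on ℝ; (ii) b̃ is one-sided Lipschitz with constant L_b̃; (iii) |b̃(z₀) − b̃(z₁)| ≤ K_b̃·(exp(γ̃|z₀|^{η̃}) + exp(γ̃|z₁|^{η̃}))·|z₀ − z₁| for all z₀, z₁ ∈ ℝ; (iv) σ̃ is globally Lipschitz with constant L_σ̃; (v) there exist α, β > 0 with max(z·b̃(z), σ̃(z)²) ≤ α + β·z² for all z ∈ ℝ. -/

import Mathlib

open MeasureTheory

/-- Absolute continuity of `f` on the set `I`: `f` is the integral of an integrable a.e.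
derivative `g` between any two points of `I`. -/
def AbsContOn (f : ℝ → ℝ) (I : Set ℝ) : Prop :=
  ∃ g : ℝ → ℝ, ∀ a ∈ I, ∀ b ∈ I,
    IntervalIntegrable g volume a b ∧ f b = f a + ∫ t in a..b, g t

/-- Condition (A1) on a set `I` with constants `L, K, γ, η`: absolute continuity,
one-sided Lipschitz continuity, and local Lipschitz continuity with exponential growth. -/
def CondA1 (f : ℝ → ℝ) (I : Set ℝ) (L K γ η : ℝ) : Prop :=
  AbsContOn f I ∧
  (∀ x ∈ I, ∀ y ∈ I, (x - y) * (f x - f y) ≤ L * |x - y| ^ 2) ∧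
  (∀ x ∈ I, ∀ y ∈ I,
    |f x - f y| ≤ K * (Real.exp (γ * |x| ^ η) + Real.exp (γ * |y| ^ η)) * |x - y|)

/-- The `k`-th open interval `(ξ_k, ξ_{k+1})` determined by the exceptional points
`ξ₁ < … < ξ_m` (indexed by `Fin m`), with the conventions `ξ₀ = -∞` and `ξ_{m+1} = ∞`. -/
def openItv (m : ℕ) (ξ : Fin m → ℝ) (k : Fin (m + 1)) : Set ℝ :=
  {x : ℝ | (∀ hk : 0 < (k : ℕ), ξ ⟨(k : ℕ) - 1, by have := k.isLt; omega⟩ < x) ∧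
    (∀ hk : (k : ℕ) < m, x < ξ ⟨(k : ℕ), hk⟩)}

/-- The basic bump `φ(u) = (1+u)³(1-u)³` on `[-1,1]`, zero outside. -/
noncomputable def phi (u : ℝ) : ℝ := if |u| ≤ 1 then (1 + u) ^ 3 * (1 - u) ^ 3 else 0

/-- The localized bump `φ̄_k(x) = φ((x-ξ)/c)·(x-ξ)·|x-ξ|`. -/
noncomputable def phibar (ξ c x : ℝ) : ℝ := phi ((x - ξ) / c) * (x - ξ) * |x - ξ|


/-! ### Helper notions -/

/-- `f` is Lipschitz on `U` with some constant. -/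
def LipOn (U : Set ℝ) (f : ℝ → ℝ) : Prop :=
  ∃ C : ℝ, 0 ≤ C ∧ ∀ x ∈ U, ∀ y ∈ U, |f x - f y| ≤ C * |x - y|

/-- `f` is bounded on `U`. -/
def BdOn (U : Set ℝ) (f : ℝ → ℝ) : Prop :=
  ∃ M : ℝ, 0 ≤ M ∧ ∀ x ∈ U, |f x| ≤ M

lemma LipOn.mono {U V : Set ℝ} {f : ℝ → ℝ} (h : LipOn U f) (hVU : V ⊆ U) : LipOn V f := by
  obtain ⟨C, hC, h⟩ := h
  exact ⟨C, hC, fun x hx y hy => h x (hVU hx) y (hVU hy)⟩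

lemma BdOn.mono {U V : Set ℝ} {f : ℝ → ℝ} (h : BdOn U f) (hVU : V ⊆ U) : BdOn V f := by
  obtain ⟨C, hC, h⟩ := h
  exact ⟨C, hC, fun x hx => h x (hVU hx)⟩

lemma LipOn.congr {U : Set ℝ} {f g : ℝ → ℝ} (h : LipOn U f) (hfg : ∀ x ∈ U, g x = f x) :
    LipOn U g := by
  obtain ⟨C, hC, h⟩ := h
  exact ⟨C, hC, fun x hx y hy => by rw [hfg x hx, hfg y hy]; exact h x hx y hy⟩

lemma LipOn.const (U : Set ℝ) (a : ℝ) : LipOn U (fun _ => a) :=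
  ⟨0, le_rfl, fun _ _ _ _ => by simp⟩

lemma BdOn.const (U : Set ℝ) (a : ℝ) : BdOn U (fun _ => a) :=
  ⟨|a|, abs_nonneg a, fun _ _ => le_rfl⟩

lemma LipOn.add {U : Set ℝ} {f g : ℝ → ℝ} (hf : LipOn U f) (hg : LipOn U g) :
    LipOn U (fun x => f x + g x) := by
  obtain ⟨C, hC, hf⟩ := hf
  obtain ⟨D, hD, hg⟩ := hg
  refine ⟨C + D, by positivity, fun x hx y hy => ?_⟩
  calc |f x + g x - (f y + g y)| = |(f x - f y) + (g x - g y)| := by ring_nf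
    _ ≤ |f x - f y| + |g x - g y| := abs_add_le _ _
    _ ≤ C * |x - y| + D * |x - y| := add_le_add (hf x hx y hy) (hg x hx y hy)
    _ = (C + D) * |x - y| := by ring

lemma BdOn.add {U : Set ℝ} {f g : ℝ → ℝ} (hf : BdOn U f) (hg : BdOn U g) :
    BdOn U (fun x => f x + g x) := by
  obtain ⟨C, hC, hf⟩ := hf
  obtain ⟨D, hD, hg⟩ := hg
  exact ⟨C + D, by positivity, fun x hx =>
    (abs_add_le _ _).trans (add_le_add (hf x hx) (hg x hx))⟩

lemma BdOn.mul {U : Set ℝ} {f g : ℝ → ℝ} (hf : BdOn U f) (hg : BdOn U g) :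
    BdOn U (fun x => f x * g x) := by
  obtain ⟨C, hC, hf⟩ := hf
  obtain ⟨D, hD, hg⟩ := hg
  exact ⟨C * D, by positivity, fun x hx => by
    rw [abs_mul]; exact mul_le_mul (hf x hx) (hg x hx) (abs_nonneg _) hC⟩

lemma LipOn.const_mul {U : Set ℝ} {f : ℝ → ℝ} (a : ℝ) (hf : LipOn U f) :
    LipOn U (fun x => a * f x) := by
  obtain ⟨C, hC, hf⟩ := hf
  refine ⟨|a| * C, by positivity, fun x hx y hy => ?_⟩
  rw [← mul_sub, abs_mul, mul_assoc]
  exact mul_le_mul_of_nonneg_left (hf x hx y hy) (abs_nonneg _)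

lemma LipOn.sum {ι : Type*} (s : Finset ι) {U : Set ℝ} {f : ι → ℝ → ℝ}
    (hf : ∀ i, LipOn U (f i)) : LipOn U (fun x => ∑ i ∈ s, f i x) := by
  classical
  induction s using Finset.induction_on with
  | empty => simpa using LipOn.const U 0
  | insert a s ha ih =>
    simp only [Finset.sum_insert ha]
    exact (hf a).add ih

/-- Product of `f`, Lipschitz and bounded on `U ∩ K`, with `g`, Lipschitz and bounded on `U` and
vanishing off `K`. -/
lemma LipOn.mul_supp {U K : Set ℝ} {f g : ℝ → ℝ} (hf : LipOn (U ∩ K) f) (hfb : BdOn (U ∩ K) f)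
    (hg : LipOn U g) (hgb : BdOn U g) (h0 : ∀ x, x ∉ K → g x = 0) :
    LipOn U (fun x => f x * g x) := by
  obtain ⟨A, hA, hf⟩ := hf
  obtain ⟨M, hM, hfb⟩ := hfb
  obtain ⟨C, hC, hg⟩ := hg
  obtain ⟨N, hN, hgb⟩ := hgb
  refine ⟨N * A + M * C, by positivity, fun x hx y hy => ?_⟩
  have hxy := abs_nonneg (x - y)
  by_cases hxK : x ∈ K
  · by_cases hyK : y ∈ K
    · calc |f x * g x - f y * g y| = |g x * (f x - f y) + f y * (g x - g y)| := by ring_nf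
        _ ≤ |g x * (f x - f y)| + |f y * (g x - g y)| := abs_add_le _ _
        _ = |g x| * |f x - f y| + |f y| * |g x - g y| := by rw [abs_mul, abs_mul]
        _ ≤ N * (A * |x - y|) + M * (C * |x - y|) :=
            add_le_add
              (mul_le_mul (hgb x hx) (hf x ⟨hx, hxK⟩ y ⟨hy, hyK⟩) (abs_nonneg _) hN)
              (mul_le_mul (hfb y ⟨hy, hyK⟩) (hg x hx y hy) (abs_nonneg _) hM)
        _ = (N * A + M * C) * |x - y| := by ring
    · have e : f x * g x - f y * g y = f x * (g x - g y) := by rw [h0 y hyK]; ring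
      rw [e, abs_mul]
      calc |f x| * |g x - g y| ≤ M * (C * |x - y|) :=
            mul_le_mul (hfb x ⟨hx, hxK⟩) (hg x hx y hy) (abs_nonneg _) hM
        _ ≤ (N * A + M * C) * |x - y| := by nlinarith [mul_nonneg (mul_nonneg hN hA) hxy]
  · by_cases hyK : y ∈ K
    · have e : f x * g x - f y * g y = f y * (g x - g y) := by rw [h0 x hxK]; ring
      rw [e, abs_mul]
      calc |f y| * |g x - g y| ≤ M * (C * |x - y|) :=
            mul_le_mul (hfb y ⟨hy, hyK⟩) (hg x hx y hy) (abs_nonneg _) hM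
        _ ≤ (N * A + M * C) * |x - y| := by nlinarith [mul_nonneg (mul_nonneg hN hA) hxy]
    · simp only [h0 x hxK, h0 y hyK, mul_zero, sub_zero, abs_zero]
      positivity

lemma LipOn.mul {U : Set ℝ} {f g : ℝ → ℝ} (hf : LipOn U f) (hfb : BdOn U f)
    (hg : LipOn U g) (hgb : BdOn U g) : LipOn U (fun x => f x * g x) := by
  apply LipOn.mul_supp (K := Set.univ) _ _ hg hgb (by simp)
  · simpa using hf
  · simpa using hfb

lemma LipOn.bdOn {U : Set ℝ} {f : ℝ → ℝ} {a b : ℝ} (hf : LipOn U f)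
    (hU : U ⊆ Set.Icc a b) : BdOn U f := by
  obtain ⟨C, hC, hf⟩ := hf
  rcases U.eq_empty_or_nonempty with rfl | ⟨x₀, hx₀⟩
  · exact ⟨0, le_rfl, by simp⟩
  have hab : 0 ≤ b - a := by
    have := hU hx₀
    linarith [this.1, this.2]
  refine ⟨|f x₀| + C * (b - a), by positivity, fun x hx => ?_⟩
  have h1 := hf x hx x₀ hx₀
  have h2 : |x - x₀| ≤ b - a := by
    have := hU hx₀
    have := hU hx
    rw [abs_le]
    constructor <;> linarith [this.1, this.2, (hU hx₀).1, (hU hx₀).2]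
  have h3 : C * |x - x₀| ≤ C * (b - a) := mul_le_mul_of_nonneg_left h2 hC
  have h4 : |f x| ≤ |f x₀| + |f x - f x₀| := by
    calc |f x| = |f x₀ + (f x - f x₀)| := by ring_nf
      _ ≤ _ := abs_add_le _ _
  linarith

lemma LipOn.continuous {f : ℝ → ℝ} (hf : LipOn Set.univ f) : Continuous f := by
  obtain ⟨C, hC, hf⟩ := hf
  have : LipschitzWith (Real.toNNReal C) f := by
    apply LipschitzWith.of_dist_le_mul
    intro x y
    rw [Real.coe_toNNReal C hC, Real.dist_eq, Real.dist_eq]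
    exact hf x trivial y trivial
  exact this.continuous

/-! ### The bump and its derivatives -/

noncomputable def wc (c t : ℝ) : ℝ := max 0 (1 - (t / c) ^ 2)

noncomputable def p1 (c t : ℝ) : ℝ := |t| * (wc c t) ^ 2 * (2 - 8 * (t / c) ^ 2)

noncomputable def qq (c t : ℝ) : ℝ := wc c t * (2 - 34 * (t / c) ^ 2 + 56 * (t / c) ^ 4)

noncomputable def p2 (c t : ℝ) : ℝ := (SignType.sign t : ℝ) * qq c t

lemma hasDerivAt_max_pow (n : ℕ) (y : ℝ) :
    HasDerivAt (fun y : ℝ => (max 0 y) ^ (n + 2)) ((n + 2) * (max 0 y) ^ (n + 1)) y := by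
  rcases lt_trichotomy y 0 with h | h | h
  · have h1 : (fun y : ℝ => (max 0 y) ^ (n + 2)) =ᶠ[nhds y] fun _ => 0 := by
      filter_upwards [Iio_mem_nhds h] with z hz
      rw [max_eq_left (le_of_lt hz)]; simp
    rw [max_eq_left h.le]
    simpa using (hasDerivAt_const y (0:ℝ)).congr_of_eventuallyEq h1
  · subst h
    simp only [max_self]
    rw [hasDerivAt_iff_isLittleO]
    have h2 : (fun x' : ℝ => max 0 x' ^ (n + 2) - max 0 0 ^ (n + 2) -
        (x' - 0) • (((n:ℝ) + 2) * 0 ^ (n + 1))) = fun x' : ℝ => max 0 x' ^ (n + 2) := by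
      ext; simp
    rw [h2]
    simp only [sub_zero]
    have h3 : (fun x' : ℝ => max 0 x' ^ (n + 2)) =O[nhds 0] fun x' : ℝ => x' ^ (n + 2) := by
      apply Asymptotics.isBigO_of_le
      intro x
      rw [norm_pow, norm_pow]
      apply pow_le_pow_left₀ (norm_nonneg _)
      rw [Real.norm_eq_abs, Real.norm_eq_abs, abs_of_nonneg (le_max_left _ _)]
      exact max_le (abs_nonneg _) (le_abs_self _)
    exact h3.trans_isLittleO (Asymptotics.isLittleO_pow_id (by omega))
  · have h1 : (fun y : ℝ => (max 0 y) ^ (n + 2)) =ᶠ[nhds y] fun y => y ^ (n + 2) := by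
      filter_upwards [Ioi_mem_nhds h] with z hz
      rw [max_eq_right (le_of_lt hz)]
    rw [max_eq_right h.le]
    have := (hasDerivAt_pow (n + 2) y).congr_of_eventuallyEq h1
    push_cast at this
    simpa using this

lemma hasDerivAt_mul_abs (t : ℝ) : HasDerivAt (fun t : ℝ => t * |t|) (2 * |t|) t := by
  rcases eq_or_ne t 0 with rfl | h
  · rw [hasDerivAt_iff_isLittleO]
    simp only [abs_zero, mul_zero, sub_zero, smul_eq_mul]
    have h3 : (fun x' : ℝ => x' * |x'|) =O[nhds 0] fun x' : ℝ => x' ^ 2 := by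
      apply Asymptotics.isBigO_of_le
      intro x
      rw [norm_pow, norm_mul, Real.norm_eq_abs, Real.norm_eq_abs, abs_abs, sq]
    exact h3.trans_isLittleO (Asymptotics.isLittleO_pow_id (by omega))
  · refine ((hasDerivAt_id t).mul (hasDerivAt_abs h)).congr_deriv ?_
    have := sign_mul_self t
    simp only [id]
    linarith

lemma hasDerivAt_base (c t : ℝ) (hc : 0 < c) :
    HasDerivAt (fun t : ℝ => 1 - (t / c) ^ 2) (-(2 * (t / c) / c)) t := by
  have := (((hasDerivAt_id t).div_const c).pow 2).const_sub 1
  refine this.congr_deriv ?_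
  simp only [id]
  push_cast
  ring

lemma wc_mul (c t : ℝ) : wc c t * (1 - (t / c) ^ 2) = wc c t ^ 2 := by
  unfold wc
  rcases le_total 0 (1 - (t / c) ^ 2) with h | h
  · rw [max_eq_right h]; ring
  · rw [max_eq_left h]; ring

lemma hasDerivAt_P (c t : ℝ) (hc : 0 < c) :
    HasDerivAt (fun t : ℝ => wc c t ^ 3 * (t * |t|)) (p1 c t) t := by
  have h1 : HasDerivAt (fun t : ℝ => wc c t ^ 3) _ t :=
    (hasDerivAt_max_pow 1 _).comp t (hasDerivAt_base c t hc)
  have h := h1.mul (hasDerivAt_mul_abs t)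
  refine h.congr_deriv (Eq.symm ?_)
  have hw := wc_mul c t
  change p1 c t = ((1:ℕ) + 2) * wc c t ^ (1 + 1) * (-(2 * (t / c) / c)) * (t * |t|)
    + wc c t ^ 3 * (2 * |t|)
  have h3 : wc c t ^ 3 = wc c t ^ 2 * (1 - (t / c) ^ 2) := by
    linear_combination (-wc c t) * hw
  rw [h3]
  unfold p1
  push_cast
  field_simp
  ring

lemma hasDerivAt_p1 (c t : ℝ) (hc : 0 < c) (ht : t ≠ 0) :
    HasDerivAt (p1 c) (p2 c t) t := by
  have h1 : HasDerivAt (fun t : ℝ => wc c t ^ 2) _ t :=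
    (hasDerivAt_max_pow 0 _).comp t (hasDerivAt_base c t hc)
  have h2 : HasDerivAt (fun t : ℝ => 2 - 8 * (t / c) ^ 2) (-(16 * (t / c) / c)) t := by
    have := ((((hasDerivAt_id t).div_const c).pow 2).const_mul 8).const_sub 2
    refine this.congr_deriv ?_
    simp only [id]
    push_cast
    ring
  have h := ((hasDerivAt_abs ht).mul h1).mul h2
  refine h.congr_deriv (Eq.symm ?_)
  have hw := wc_mul c t
  have hs : |t| = (SignType.sign t : ℝ) * t := (sign_mul_self t).symm
  change p2 c t = ((SignType.sign t : ℝ) * wc c t ^ 2 +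
     |t| * (((0:ℕ) + 2) * wc c t ^ (0 + 1) * (-(2 * (t / c) / c)))) * (2 - 8 * (t / c) ^ 2)
     + |t| * wc c t ^ 2 * (-(16 * (t / c) / c))
  rw [hs, ← hw]
  unfold p2 qq
  push_cast
  field_simp
  ring

lemma wc_zero {c t : ℝ} (hc : 0 < c) (h : c ≤ |t|) : wc c t = 0 := by
  unfold wc
  apply max_eq_left
  have : 1 ≤ |t / c| := by rw [abs_div, abs_of_pos hc, le_div_iff₀ hc]; linarith
  have := one_le_sq_iff_one_le_abs (t / c) |>.2 this
  linarith

lemma p1_zero {c t : ℝ} (hc : 0 < c) (h : c ≤ |t|) : p1 c t = 0 := by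
  simp [p1, wc_zero hc h]

lemma qq_zero {c t : ℝ} (hc : 0 < c) (h : c ≤ |t|) : qq c t = 0 := by
  simp [qq, wc_zero hc h]

lemma p2_zero {c t : ℝ} (hc : 0 < c) (h : c ≤ |t|) : p2 c t = 0 := by
  simp [p2, qq_zero hc h]

lemma phibar_eq (ξ c x : ℝ) : phibar ξ c x = wc c (x - ξ) ^ 3 * ((x - ξ) * |x - ξ|) := by
  unfold phibar phi wc
  set u := (x - ξ) / c
  rw [mul_assoc]
  congr 1
  split_ifs with h
  · rw [max_eq_right]
    · ring
    · have := (sq_le_one_iff_abs_le_one u).2 h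
      linarith
  · rw [max_eq_left]
    · simp
    · push Not at h
      have := one_le_sq_iff_one_le_abs u |>.2 h.le
      linarith

lemma hasDerivAt_phibar (ξ c x : ℝ) (hc : 0 < c) :
    HasDerivAt (phibar ξ c) (p1 c (x - ξ)) x := by
  have : phibar ξ c = fun x => (fun t : ℝ => wc c t ^ 3 * (t * |t|)) (x - ξ) := by
    ext x; exact phibar_eq ξ c x
  rw [this]
  exact (hasDerivAt_P c (x - ξ) hc).comp_sub_const x ξ

/-- clamp of `|t|/c` -/
noncomputable def sc (c t : ℝ) : ℝ := min (|t| / c) 1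

lemma sc_lip (c : ℝ) (hc : 0 < c) : LipOn Set.univ (sc c) := by
  refine ⟨1 / c, by positivity, fun x _ y _ => ?_⟩
  unfold sc
  have h1 := abs_min_sub_min_le_max (|x| / c) 1 (|y| / c) 1
  have h2 : |(|x| / c - |y| / c)| ≤ 1 / c * |x - y| := by
    rw [← sub_div, abs_div, abs_of_pos hc, div_mul_eq_mul_div, one_mul]
    exact div_le_div_of_nonneg_right (abs_abs_sub_abs_le x y) hc.le
  refine h1.trans ?_
  simp only [sub_self, abs_zero]
  exact max_le h2 (by positivity)

lemma sc_bd (c : ℝ) (hc : 0 < c) : BdOn Set.univ (sc c) := by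
  refine ⟨1, by norm_num, fun x _ => ?_⟩
  have : 0 ≤ sc c x := le_min (by positivity) (by norm_num)
  rw [abs_of_nonneg this]
  exact min_le_right _ _

def LB (f : ℝ → ℝ) : Prop := LipOn Set.univ f ∧ BdOn Set.univ f
lemma LB.const (a : ℝ) : LB (fun _ => a) := ⟨LipOn.const _ _, BdOn.const _ _⟩
lemma LB.add {f g : ℝ → ℝ} (hf : LB f) (hg : LB g) : LB (fun x => f x + g x) :=
  ⟨hf.1.add hg.1, hf.2.add hg.2⟩
lemma LB.mul {f g : ℝ → ℝ} (hf : LB f) (hg : LB g) : LB (fun x => f x * g x) :=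
  ⟨hf.1.mul hf.2 hg.1 hg.2, hf.2.mul hg.2⟩

lemma p1_sc (c t : ℝ) (hc : 0 < c) : p1 c t = c * (sc c t * ((1 + (-1) * (sc c t * sc c t)) *
    ((1 + (-1) * (sc c t * sc c t)) * (2 + (-8) * (sc c t * sc c t))))) := by
  rcases le_total (|t|) c with h | h
  · have h1 : sc c t = |t| / c := min_eq_left ((div_le_one hc).2 h)
    have h2 : wc c t = 1 - (t / c) ^ 2 := max_eq_right (by
      have : (t / c) ^ 2 ≤ 1 := by
        rw [sq_le_one_iff_abs_le_one, abs_div, abs_of_pos hc]; exact (div_le_one hc).2 h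
      linarith)
    have h3 : sc c t * sc c t = (t / c) ^ 2 := by
      rw [h1, div_mul_div_comm, abs_mul_abs_self, div_pow, sq, sq]
    rw [h3, p1, h2, h1]
    field_simp
    ring
  · rw [p1_zero hc h]
    have h1 : sc c t = 1 := min_eq_right ((one_le_div hc).2 h)
    rw [h1]; ring

lemma qq_sc (c t : ℝ) (hc : 0 < c) : qq c t = (1 + (-1) * (sc c t * sc c t)) *
    (2 + ((-34) * (sc c t * sc c t) + 56 * ((sc c t * sc c t) * (sc c t * sc c t)))) := by
  rcases le_total (|t|) c with h | h
  · have h1 : sc c t = |t| / c := min_eq_left ((div_le_one hc).2 h)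
    have h2 : wc c t = 1 - (t / c) ^ 2 := max_eq_right (by
      have : (t / c) ^ 2 ≤ 1 := by
        rw [sq_le_one_iff_abs_le_one, abs_div, abs_of_pos hc]; exact (div_le_one hc).2 h
      linarith)
    have h3 : sc c t * sc c t = (t / c) ^ 2 := by
      rw [h1, div_mul_div_comm, abs_mul_abs_self, div_pow, sq, sq]
    rw [h3, qq, h2]
    ring
  · rw [qq_zero hc h]
    have h1 : sc c t = 1 := min_eq_right ((one_le_div hc).2 h)
    rw [h1]; ring

lemma p1_LB (c : ℝ) (hc : 0 < c) : LB (p1 c) := by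
  have hs : LB (sc c) := ⟨sc_lip c hc, sc_bd c hc⟩
  have h2 := hs.mul hs
  have h3 := (LB.const 1).add ((LB.const (-1)).mul h2)
  have h4 := (LB.const 2).add ((LB.const (-8)).mul h2)
  have h5 := (LB.const c).mul (hs.mul (h3.mul (h3.mul h4)))
  have e : p1 c = _ := funext (fun t => p1_sc c t hc)
  rw [e]
  exact h5

lemma qq_LB (c : ℝ) (hc : 0 < c) : LB (qq c) := by
  have hs : LB (sc c) := ⟨sc_lip c hc, sc_bd c hc⟩
  have h2 := hs.mul hs
  have h3 := (LB.const 1).add ((LB.const (-1)).mul h2)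
  have h4 := (LB.const 2).add (((LB.const (-34)).mul h2).add ((LB.const 56).mul (h2.mul h2)))
  have e : qq c = _ := funext (fun t => qq_sc c t hc)
  rw [e]
  exact h3.mul h4

lemma LipOn.shift {f : ℝ → ℝ} (hf : LipOn Set.univ f) (a : ℝ) :
    LipOn Set.univ (fun x => f (x - a)) := by
  obtain ⟨C, hC, hf⟩ := hf
  refine ⟨C, hC, fun x _ y _ => ?_⟩
  have := hf (x - a) trivial (y - a) trivial
  simpa using this

lemma BdOn.shift {f : ℝ → ℝ} (hf : BdOn Set.univ f) (a : ℝ) :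
    BdOn Set.univ (fun x => f (x - a)) := by
  obtain ⟨C, hC, hf⟩ := hf
  exact ⟨C, hC, fun x _ => hf (x - a) trivial⟩

lemma p1_bound (c t : ℝ) (hc : 0 < c) : |p1 c t| ≤ 6 * c := by
  rw [p1_sc c t hc]
  have h0 : 0 ≤ sc c t := le_min (by positivity) (by norm_num)
  have h1 : sc c t ≤ 1 := min_le_right _ _
  set s := sc c t
  have hv0 : 0 ≤ s * s := mul_nonneg h0 h0
  have hv1 : s * s ≤ 1 := by nlinarith
  have a1 : |1 + (-1) * (s * s)| ≤ 1 := by rw [abs_le]; constructor <;> linarith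
  have a2 : |2 + (-8) * (s * s)| ≤ 6 := by rw [abs_le]; constructor <;> linarith
  have a3 : |s| ≤ 1 := by rw [abs_le]; constructor <;> linarith
  rw [abs_mul, abs_mul, abs_mul, abs_mul, abs_of_pos hc]
  have b1 := mul_le_mul a1 a2 (abs_nonneg _) (by norm_num)
  have b2 := mul_le_mul a1 b1 (by positivity) (by norm_num)
  have b3 := mul_le_mul a3 b2 (by positivity) (by norm_num)
  nlinarith

/-! ### Gluing -/

lemma glue_base (h : ℝ → ℝ) (hc : Continuous h) (C a b : ℝ) (hab : a < b)
    (H : ∀ x y, a < x → x < y → y < b → h y - h x ≤ C * (y - x)) :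
    h b - h a ≤ C * (b - a) := by
  have h1 : Filter.Tendsto (fun t : ℝ => h (b - t) - h (a + t)) (nhdsWithin 0 (Set.Ioi 0))
      (nhds (h b - h a)) := by
    have : Continuous (fun t : ℝ => h (b - t) - h (a + t)) := by fun_prop
    have := (this.tendsto 0).mono_left (nhdsWithin_le_nhds (s := Set.Ioi 0))
    simpa using this
  have h2 : Filter.Tendsto (fun t : ℝ => C * ((b - t) - (a + t))) (nhdsWithin 0 (Set.Ioi 0))
      (nhds (C * (b - a))) := by
    have : Continuous (fun t : ℝ => C * ((b - t) - (a + t))) := by fun_prop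
    have := (this.tendsto 0).mono_left (nhdsWithin_le_nhds (s := Set.Ioi 0))
    simpa using this
  refine le_of_tendsto_of_tendsto h1 h2 ?_
  have : Set.Ioo (0:ℝ) ((b - a) / 2) ∈ nhdsWithin (0:ℝ) (Set.Ioi 0) :=
    Ioo_mem_nhdsGT (by linarith)
  filter_upwards [this] with t ht
  apply H <;> linarith [ht.1, ht.2]

lemma glue (S : Finset ℝ) (h : ℝ → ℝ) (hc : Continuous h) (C : ℝ) (n : ℕ) : ∀ (a b : ℝ), a ≤ b →
    (S.filter (fun s => a < s ∧ s < b)).card ≤ n →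
    (∀ x y, a < x → x < y → y < b → (∀ s ∈ S, ¬ (x ≤ s ∧ s ≤ y)) → h y - h x ≤ C * (y - x)) →
    h b - h a ≤ C * (b - a) := by
  induction n with
  | zero =>
    intro a b hab hn H
    rcases hab.eq_or_lt with rfl | hab
    · simp
    rw [Nat.le_zero, Finset.card_eq_zero, Finset.filter_eq_empty_iff] at hn
    exact glue_base h hc C a b hab (fun x y hx hxy hy => H x y hx hxy hy
      (fun s hs hh => hn hs ⟨by linarith [hh.1], by linarith [hh.2]⟩))
  | succ n ih =>
    intro a b hab hn H
    by_cases hex : ∃ s ∈ S, a < s ∧ s < b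
    · obtain ⟨s, hs, has, hsb⟩ := hex
      have hsm : s ∈ S.filter (fun s => a < s ∧ s < b) := by simp [hs, has, hsb]
      have e1 : h s - h a ≤ C * (s - a) := by
        apply ih a s has.le
        · have : S.filter (fun t => a < t ∧ t < s) ⊆
              (S.filter (fun s => a < s ∧ s < b)).erase s := by
            intro t ht
            simp only [Finset.mem_filter, Finset.mem_erase] at ht ⊢
            exact ⟨ne_of_lt ht.2.2, ht.1, ht.2.1, by linarith [ht.2.2]⟩
          have := Finset.card_le_card this
          rw [Finset.card_erase_of_mem hsm] at this
          omega
        · intro x y hx hxy hy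
          exact H x y hx hxy (by linarith)
      have e2 : h b - h s ≤ C * (b - s) := by
        apply ih s b hsb.le
        · have : S.filter (fun t => s < t ∧ t < b) ⊆
              (S.filter (fun s => a < s ∧ s < b)).erase s := by
            intro t ht
            simp only [Finset.mem_filter, Finset.mem_erase] at ht ⊢
            exact ⟨ne_of_gt ht.2.1, ht.1, by linarith [ht.2.1], ht.2.2⟩
          have := Finset.card_le_card this
          rw [Finset.card_erase_of_mem hsm] at this
          omega
        · intro x y hx hxy hy
          exact H x y (by linarith) hxy hy
      linarith
    · push Not at hex
      apply ih a b hab _ H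
      have : S.filter (fun s => a < s ∧ s < b) = ∅ := by
        rw [Finset.filter_eq_empty_iff]
        intro s hs hh
        exact absurd hh.2 (not_lt.2 (hex s hs hh.1))
      simp [this]

lemma glue' (S : Finset ℝ) (h : ℝ → ℝ) (hc : Continuous h) (C a b : ℝ) (hab : a ≤ b)
    (H : ∀ x y, a < x → x < y → y < b → (∀ s ∈ S, ¬ (x ≤ s ∧ s ≤ y)) →
      h y - h x ≤ C * (y - x)) :
    h b - h a ≤ C * (b - a) :=
  glue S h hc C _ a b hab le_rfl H

/-- Absolute continuity from local Lipschitz continuity. -/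
lemma absCont_of_lip (f : ℝ → ℝ) (h : ∀ a b : ℝ, LipOn (Set.uIcc a b) f) :
    AbsContOn f Set.univ := by
  refine ⟨deriv f, fun a _ b _ => ?_⟩
  obtain ⟨C, hC, hf⟩ := h a b
  have : LipschitzOnWith (Real.toNNReal C) f (Set.uIcc a b) := by
    apply LipschitzOnWith.of_dist_le_mul
    intro x hx y hy
    rw [Real.coe_toNNReal C hC, Real.dist_eq, Real.dist_eq]
    exact hf x hx y hy
  have hac := this.absolutelyContinuousOnInterval
  refine ⟨hac.intervalIntegrable_deriv, ?_⟩
  rw [hac.integral_deriv_eq_sub]; ring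


/-! ### Transfer through `G⁻¹` -/

lemma exp_transfer (γ η A : ℝ) (hγ : 0 < γ) (hη : 0 < η) (hA : 0 < A) (x z : ℝ)
    (hx : |x| ≤ A * (1 + |z|)) :
    Real.exp (γ * |x| ^ η) ≤
      Real.exp (γ * (2 * A) ^ η) * Real.exp (γ * (2 * A) ^ η * |z| ^ η) := by
  rw [← Real.exp_add]
  apply Real.exp_le_exp.2
  have h1 : |x| ≤ (2 * A) * max 1 |z| := by
    have := le_max_left 1 |z|
    have := le_max_right 1 |z|
    nlinarith
  have h2 : |x| ^ η ≤ (2 * A) ^ η * (max 1 |z|) ^ η := by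
    rw [← Real.mul_rpow (by positivity) (by positivity)]
    exact Real.rpow_le_rpow (abs_nonneg _) h1 hη.le
  have h3 : (max 1 |z|) ^ η ≤ 1 + |z| ^ η := by
    have hz : 0 ≤ |z| ^ η := Real.rpow_nonneg (abs_nonneg _) _
    rcases max_choice 1 |z| with h | h <;> rw [h]
    · rw [Real.one_rpow]; linarith
    · linarith
  have h4 : 0 ≤ (2 * A) ^ η := Real.rpow_nonneg (by positivity) _
  have h5 := mul_le_mul_of_nonneg_left h3 h4
  have h6 := mul_le_mul_of_nonneg_left (h2.trans h5) hγ.le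
  linarith

lemma invFun_facts (G : ℝ → ℝ) (hGc : Continuous G) (δ : ℝ) (hδ : 0 < δ)
    (hG : ∀ x y, x ≤ y → δ * (y - x) ≤ G y - G x) :
    (∀ x, Function.invFun G (G x) = x) ∧ (∀ z, G (Function.invFun G z) = z) ∧
    (∀ z w, z ≤ w → Function.invFun G z ≤ Function.invFun G w) ∧
    (∀ z w, |Function.invFun G z - Function.invFun G w| ≤ 1 / δ * |z - w|) := by
  have hmono : StrictMono G := by
    intro x y hxy
    have := hG x y hxy.le
    have : 0 < δ * (y - x) := mul_pos hδ (by linarith)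
    linarith
  have hsurj : Function.Surjective G := by
    apply hGc.surjective
    · have h1 : Filter.Tendsto (fun x : ℝ => G 0 + δ * x) Filter.atTop Filter.atTop :=
        Filter.tendsto_atTop_add_const_left _ _ (Filter.tendsto_id.const_mul_atTop hδ)
      refine Filter.tendsto_atTop_mono' _ ?_ h1
      filter_upwards [Filter.eventually_ge_atTop 0] with x hx
      have := hG 0 x hx
      linarith
    · have h1 : Filter.Tendsto (fun x : ℝ => G 0 + δ * x) Filter.atBot Filter.atBot :=
        Filter.tendsto_atBot_add_const_left _ _ (Filter.tendsto_id.const_mul_atBot hδ)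
      refine Filter.tendsto_atBot_mono' _ ?_ h1
      filter_upwards [Filter.eventually_le_atBot 0] with x hx
      have := hG x 0 hx
      linarith
  have hr : ∀ z, G (Function.invFun G z) = z := Function.rightInverse_invFun hsurj
  have hl : ∀ x, Function.invFun G (G x) = x := Function.leftInverse_invFun hmono.injective
  have hm : ∀ z w, z ≤ w → Function.invFun G z ≤ Function.invFun G w := by
    intro z w hzw
    rw [← hmono.le_iff_le, hr, hr]; exact hzw
  refine ⟨hl, hr, hm, ?_⟩
  have key : ∀ z w, z ≤ w →
      |Function.invFun G z - Function.invFun G w| ≤ 1 / δ * |z - w| := by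
    intro z w hzw
    have h1 := hm z w hzw
    have h2 := hG _ _ h1
    rw [hr, hr] at h2
    rw [abs_sub_comm, abs_of_nonneg (by linarith), abs_sub_comm, abs_of_nonneg (by linarith),
      div_mul_eq_mul_div, one_mul, le_div_iff₀ hδ]
    linarith
  intro z w
  rcases le_total z w with h | h
  · exact key z w h
  · rw [abs_sub_comm, abs_sub_comm z]; exact key w z h

lemma transfer (G B : ℝ → ℝ) (hGc : Continuous G) (hBc : Continuous B) (δ : ℝ) (hδ : 0 < δ)
    (hG : ∀ x y, x ≤ y → δ * (y - x) ≤ G y - G x)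
    (L K γ η : ℝ) (hL : 0 < L) (hK : 0 < K) (hγ : 0 < γ) (hη : 0 < η)
    (h1 : ∀ x y, x ≤ y → B y - B x ≤ L * (y - x))
    (h2 : ∀ x y, |B x - B y| ≤
      K * (Real.exp (γ * |x| ^ η) + Real.exp (γ * |y| ^ η)) * |x - y|) :
    ∃ Lbt Kbt γt ηt : ℝ, 0 < Lbt ∧ 0 < Kbt ∧ 0 < γt ∧ 0 < ηt ∧
      Continuous (fun z => B (Function.invFun G z)) ∧
      AbsContOn (fun z => B (Function.invFun G z)) Set.univ ∧
      (∀ z w : ℝ, (z - w) * (B (Function.invFun G z) - B (Function.invFun G w))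
        ≤ Lbt * |z - w| ^ 2) ∧
      (∀ z₀ z₁ : ℝ, |B (Function.invFun G z₀) - B (Function.invFun G z₁)| ≤
          Kbt * (Real.exp (γt * |z₀| ^ ηt) + Real.exp (γt * |z₁| ^ ηt)) * |z₀ - z₁|) := by
  obtain ⟨hl, hr, hm, hlip⟩ := invFun_facts G hGc δ hδ hG
  set F := Function.invFun G
  have hFc : Continuous F := by
    apply LipOn.continuous
    exact ⟨1 / δ, by positivity, fun x _ y _ => hlip x y⟩
  set A := |F 0| + 1 / δ with hA
  have hApos : 0 < A := by positivity
  have hFb : ∀ z, |F z| ≤ A * (1 + |z|) := by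
    intro z
    have e1 := hlip z 0
    rw [sub_zero] at e1
    have e2 : |F z| ≤ |F 0| + |F z - F 0| := by
      calc |F z| = |F 0 + (F z - F 0)| := by ring_nf
        _ ≤ _ := abs_add_le _ _
    have e3 : 0 < 1 / δ := by positivity
    rw [hA]
    nlinarith [abs_nonneg (F 0), abs_nonneg z, mul_nonneg (abs_nonneg (F 0)) (abs_nonneg z)]
  set g := γ * (2 * A) ^ η with hg
  have hgpos : 0 < g := mul_pos hγ (Real.rpow_pos_of_pos (by positivity) _)
  have hexp : ∀ z, Real.exp (γ * |F z| ^ η) ≤ Real.exp g * Real.exp (g * |z| ^ η) :=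
    fun z => exp_transfer γ η A hγ hη hApos (F z) z (hFb z)
  have hthird : ∀ z₀ z₁ : ℝ, |B (F z₀) - B (F z₁)| ≤
      (K * Real.exp g * (1 / δ)) * (Real.exp (g * |z₀| ^ η) + Real.exp (g * |z₁| ^ η))
        * |z₀ - z₁| := by
    intro z₀ z₁
    calc |B (F z₀) - B (F z₁)|
        ≤ K * (Real.exp (γ * |F z₀| ^ η) + Real.exp (γ * |F z₁| ^ η)) * |F z₀ - F z₁| := h2 _ _
      _ ≤ K * (Real.exp g * Real.exp (g * |z₀| ^ η) + Real.exp g * Real.exp (g * |z₁| ^ η))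
          * (1 / δ * |z₀ - z₁|) := by
          apply mul_le_mul _ (hlip _ _) (abs_nonneg _) (by positivity)
          exact mul_le_mul_of_nonneg_left (add_le_add (hexp _) (hexp _)) hK.le
      _ = _ := by ring
  refine ⟨L / δ, K * Real.exp g * (1 / δ), g, η, by positivity, by positivity, hgpos, hη,
    hBc.comp hFc, ?_, ?_, hthird⟩
  · apply absCont_of_lip
    intro a b
    set E := Real.exp (g * (|a| + |b|) ^ η)
    refine ⟨(K * Real.exp g * (1 / δ)) * (E + E), by positivity, fun x hx y hy => ?_⟩
    refine (hthird x y).trans ?_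
    have hE : ∀ x ∈ Set.uIcc a b, Real.exp (g * |x| ^ η) ≤ E := by
      intro x hx
      apply Real.exp_le_exp.2
      apply mul_le_mul_of_nonneg_left _ hgpos.le
      apply Real.rpow_le_rpow (abs_nonneg _) _ hη.le
      rw [Set.mem_uIcc] at hx
      have := abs_le.1 (le_refl |a|)
      have := abs_le.1 (le_refl |b|)
      rw [abs_le]
      rcases hx with hx | hx <;> constructor <;> linarith [abs_nonneg a, abs_nonneg b]
    apply mul_le_mul_of_nonneg_right _ (abs_nonneg _)
    apply mul_le_mul_of_nonneg_left (add_le_add (hE x hx) (hE y hy)) (by positivity)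
  · have key : ∀ z w : ℝ, z ≤ w → (w - z) * (B (F w) - B (F z)) ≤ L / δ * |w - z| ^ 2 := by
      intro z w hzw
      have e1 := h1 _ _ (hm z w hzw)
      have e2 := hlip w z
      rw [abs_of_nonneg (by linarith [hm z w hzw]), abs_of_nonneg (by linarith)] at e2
      rw [abs_of_nonneg (by linarith)]
      have e3 : L * (F w - F z) ≤ L * (1 / δ * (w - z)) := mul_le_mul_of_nonneg_left e2 hL.le
      have e4 := mul_le_mul_of_nonneg_left (e1.trans e3) (by linarith : 0 ≤ w - z)
      calc _ ≤ _ := e4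
        _ = L / δ * (w - z) ^ 2 := by ring
    intro z w
    rcases le_total z w with h | h
    · have := key z w h
      rw [abs_sub_comm]
      linarith
    · exact key w z h

/-! ### The intervals -/

lemma openItv_side {m : ℕ} {ξ : Fin m → ℝ} (hξ : StrictMono ξ) (k : Fin (m + 1)) (j : Fin m) :
    (∀ x ∈ openItv m ξ k, ξ j < x) ∨ (∀ x ∈ openItv m ξ k, x < ξ j) := by
  rcases lt_or_ge (j : ℕ) (k : ℕ) with h | h
  · left
    intro x hx
    refine lt_of_le_of_lt ?_ (hx.1 (by omega))
    apply hξ.monotone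
    rw [Fin.le_def]; simp; omega
  · right
    intro x hx
    have hj := j.isLt
    refine lt_of_lt_of_le (hx.2 (by omega)) ?_
    apply hξ.monotone
    rw [Fin.le_def]; exact h

lemma exists_openItv {m : ℕ} {ξ : Fin m → ℝ} (hξ : StrictMono ξ) (x y : ℝ) (hxy : x ≤ y)
    (h : ∀ j, ¬ (x ≤ ξ j ∧ ξ j ≤ y)) :
    ∃ k : Fin (m + 1), x ∈ openItv m ξ k ∧ y ∈ openItv m ξ k := by
  classical
  have hex : ∃ n : ℕ, ∀ i : Fin m, n ≤ (i : ℕ) → x ≤ ξ i :=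
    ⟨m, fun i hi => absurd i.isLt (by omega)⟩
  have hspec := Nat.find_spec hex
  have hmin : ∀ n < Nat.find hex, ¬ ∀ i : Fin m, n ≤ (i : ℕ) → x ≤ ξ i :=
    fun n hn => Nat.find_min hex hn
  have hle : Nat.find hex ≤ m := Nat.find_min' hex (fun i hi => absurd i.isLt (by omega))
  generalize Nat.find hex = n at hspec hmin hle
  have hlow : ∀ hk : 0 < n, ξ ⟨n - 1, by omega⟩ < x := by
    intro hk
    have := hmin (n - 1) (by omega)
    push Not at this
    obtain ⟨i, hi, hix⟩ := this
    exact lt_of_le_of_lt (hξ.monotone (by rw [Fin.le_def]; exact hi)) hix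
  have hup : ∀ hk : n < m, y < ξ ⟨n, hk⟩ := by
    intro hk
    have h1 := hspec ⟨n, hk⟩ le_rfl
    by_contra hcon
    exact h _ ⟨h1, not_lt.1 hcon⟩
  refine ⟨⟨n, by omega⟩, ⟨hlow, fun hk => lt_of_le_of_lt hxy (hup hk)⟩,
    ⟨fun hk => lt_of_lt_of_le (hlow hk) hxy, hup⟩⟩

lemma isOpen_openItv (m : ℕ) (ξ : Fin m → ℝ) (k : Fin (m + 1)) : IsOpen (openItv m ξ k) := by
  unfold openItv
  rw [Set.ofPred_and]
  apply IsOpen.inter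
  · by_cases h : 0 < (k : ℕ)
    · simp only [h, forall_true_left]; exact isOpen_Ioi
    · simp [h]
  · by_cases h : (k : ℕ) < m
    · simp only [h, forall_true_left]; exact isOpen_Iio
    · simp [h]

lemma sep {m : ℕ} {ξ : Fin m → ℝ} (hξ : StrictMono ξ) {c₀ : ℝ}
    (hc₂ : ∀ (k : ℕ) (hk : k + 1 < m) (hk' : k < m), 2 * c₀ < ξ ⟨k + 1, hk⟩ - ξ ⟨k, hk'⟩)
    (j k : Fin m) (hjk : j ≠ k) : 2 * c₀ < |ξ j - ξ k| := by
  have key : ∀ j k : Fin m, j < k → 2 * c₀ < ξ k - ξ j := by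
    intro j k hjk
    have hk := k.isLt
    have hjk' : (j : ℕ) < k := hjk
    have h1 := hc₂ j (by omega) j.isLt
    have h2 : ξ ⟨(j : ℕ) + 1, by omega⟩ ≤ ξ k :=
      hξ.monotone (by rw [Fin.le_def]; simpa using hjk')
    have h3 : ξ ⟨(j : ℕ), by omega⟩ = ξ j := rfl
    linarith
  rcases lt_or_gt_of_ne hjk with h | h
  · have := key j k h
    rw [abs_sub_comm]
    exact this.trans_le (le_abs_self _)
  · exact (key k j h).trans_le (le_abs_self _)

/-- first derivative of `G` -/
noncomputable def Dd {m : ℕ} (ξ α : Fin m → ℝ) (c x : ℝ) : ℝ := 1 + ∑ k, α k * p1 c (x - ξ k)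

/-- second derivative of `G` -/
noncomputable def Ss {m : ℕ} (ξ α : Fin m → ℝ) (c x : ℝ) : ℝ := ∑ k, α k * p2 c (x - ξ k)

lemma far {m : ℕ} {ξ : Fin m → ℝ} {c : ℝ}
    (hsep : ∀ j k : Fin m, j ≠ k → 2 * c < |ξ j - ξ k|) (k j : Fin m) (hjk : j ≠ k) (x : ℝ)
    (hx : |x - ξ k| ≤ c) : c ≤ |x - ξ j| := by
  have h1 := hsep j k hjk
  have h2 : |ξ j - ξ k| ≤ |x - ξ j| + |x - ξ k| := by
    calc |ξ j - ξ k| = |(x - ξ k) - (x - ξ j)| := by ring_nf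
      _ ≤ |x - ξ k| + |x - ξ j| := abs_sub _ _
      _ = _ := add_comm _ _
  linarith

lemma Dd_single {m : ℕ} {ξ α : Fin m → ℝ} {c : ℝ} (hc : 0 < c)
    (hsep : ∀ j k : Fin m, j ≠ k → 2 * c < |ξ j - ξ k|) (k : Fin m) (x : ℝ)
    (hx : |x - ξ k| ≤ c) : Dd ξ α c x = 1 + α k * p1 c (x - ξ k) := by
  unfold Dd
  congr 1
  apply Finset.sum_eq_single k
  · intro j _ hjk
    rw [p1_zero hc (far hsep k j hjk x hx), mul_zero]
  · simp

lemma Ss_single {m : ℕ} {ξ α : Fin m → ℝ} {c : ℝ} (hc : 0 < c)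
    (hsep : ∀ j k : Fin m, j ≠ k → 2 * c < |ξ j - ξ k|) (k : Fin m) (x : ℝ)
    (hx : |x - ξ k| ≤ c) : Ss ξ α c x = α k * p2 c (x - ξ k) := by
  unfold Ss
  apply Finset.sum_eq_single k
  · intro j _ hjk
    rw [p2_zero hc (far hsep k j hjk x hx), mul_zero]
  · simp

lemma Dd_lower {m : ℕ} {ξ α : Fin m → ℝ} {c : ℝ} (hc : 0 < c)
    (hsep : ∀ j k : Fin m, j ≠ k → 2 * c < |ξ j - ξ k|)
    (hc₁ : ∀ k : Fin m, 6 * c * |α k| < 1) : ∃ δ : ℝ, 0 < δ ∧ ∀ x, δ ≤ Dd ξ α c x := by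
  have hδ : ∃ δ : ℝ, 0 < δ ∧ δ ≤ 1 ∧ ∀ k, δ ≤ 1 - 6 * c * |α k| := by
    rcases isEmpty_or_nonempty (Fin m) with h | h
    · exact ⟨1, one_pos, le_rfl, fun k => (h.false k).elim⟩
    · obtain ⟨k, hk⟩ := Finite.exists_min (fun k => 1 - 6 * c * |α k|)
      refine ⟨1 - 6 * c * |α k|, by linarith [hc₁ k], ?_, hk⟩
      have : 0 ≤ 6 * c * |α k| := by positivity
      linarith
  obtain ⟨δ, hδ, hδ1, hδk⟩ := hδ
  refine ⟨δ, hδ, fun x => ?_⟩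
  by_cases h : ∃ k, |x - ξ k| ≤ c
  · obtain ⟨k, hk⟩ := h
    rw [Dd_single hc hsep k x hk]
    have h1 : |α k * p1 c (x - ξ k)| ≤ |α k| * (6 * c) := by
      rw [abs_mul]; exact mul_le_mul_of_nonneg_left (p1_bound c _ hc) (abs_nonneg _)
    have h2 := neg_abs_le (α k * p1 c (x - ξ k))
    have := hδk k
    linarith
  · push Not at h
    have : Dd ξ α c x = 1 := by
      unfold Dd
      rw [Finset.sum_eq_zero]
      · simp
      · intro k _
        rw [p1_zero hc (h k).le, mul_zero]
    rw [this]; exact hδ1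

lemma Dd_lip {m : ℕ} (ξ α : Fin m → ℝ) {c : ℝ} (hc : 0 < c) :
    LipOn Set.univ (Dd ξ α c) :=
  (LipOn.const _ 1).add (LipOn.sum _ (fun k => ((p1_LB c hc).1.shift (ξ k)).const_mul (α k)))

lemma hasDerivAt_Dd {m : ℕ} (ξ α : Fin m → ℝ) {c : ℝ} (hc : 0 < c) (x : ℝ)
    (hx : ∀ k, x ≠ ξ k) : HasDerivAt (Dd ξ α c) (Ss ξ α c x) x := by
  have h : HasDerivAt (fun x => ∑ k, α k * p1 c (x - ξ k)) (∑ k, α k * p2 c (x - ξ k)) x := by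
    apply HasDerivAt.fun_sum
    intro k _
    exact ((hasDerivAt_p1 c (x - ξ k) hc (sub_ne_zero.2 (hx k))).comp_sub_const x (ξ k)).const_mul
      (α k)
  exact h.const_add 1

lemma hasDerivAt_G {m : ℕ} (ξ α : Fin m → ℝ) {c : ℝ} (hc : 0 < c) (G : ℝ → ℝ)
    (hG : ∀ x : ℝ, G x = x + ∑ k : Fin m, α k * phibar (ξ k) c x) (x : ℝ) :
    HasDerivAt G (Dd ξ α c x) x := by
  have e : G = fun x => x + ∑ k : Fin m, α k * phibar (ξ k) c x := funext hG
  rw [e]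
  have h : HasDerivAt (fun x => ∑ k : Fin m, α k * phibar (ξ k) c x)
      (∑ k, α k * p1 c (x - ξ k)) x := by
    apply HasDerivAt.fun_sum
    intro k _
    exact (hasDerivAt_phibar (ξ k) c x hc).const_mul (α k)
  exact (hasDerivAt_id x).add h

lemma supp_Icc {c ξ x : ℝ} (h : x ∉ Set.Icc (ξ - c) (ξ + c)) : c ≤ |x - ξ| := by
  by_contra hcon
  push Not at hcon
  rw [abs_lt] at hcon
  exact h ⟨by linarith [hcon.1], by linarith [hcon.2]⟩

/-- The drift correction is Lipschitz on each interval. -/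
lemma b_lip {b : ℝ → ℝ} {U : Set ℝ} {K γ η : ℝ} (hK : 0 < K) (hγ : 0 < γ) (hη : 0 < η)
    (h : ∀ x ∈ U, ∀ y ∈ U,
      |b x - b y| ≤ K * (Real.exp (γ * |x| ^ η) + Real.exp (γ * |y| ^ η)) * |x - y|)
    (p q : ℝ) : LipOn (U ∩ Set.Icc p q) b := by
  set E := Real.exp (γ * (|p| + |q|) ^ η)
  refine ⟨K * (E + E), by positivity, fun x hx y hy => ?_⟩
  refine (h x hx.1 y hy.1).trans ?_
  have hE : ∀ x ∈ Set.Icc p q, Real.exp (γ * |x| ^ η) ≤ E := by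
    intro x hx
    apply Real.exp_le_exp.2
    apply mul_le_mul_of_nonneg_left _ hγ.le
    apply Real.rpow_le_rpow (abs_nonneg _) _ hη.le
    have := abs_le.1 (le_refl |p|)
    have := abs_le.1 (le_refl |q|)
    rw [abs_le]
    constructor <;> linarith [abs_nonneg p, abs_nonneg q, hx.1, hx.2]
  apply mul_le_mul_of_nonneg_right _ (abs_nonneg _)
  exact mul_le_mul_of_nonneg_left (add_le_add (hE x hx.2) (hE y hy.2)) hK.le

lemma sigma_lip {σ : ℝ → ℝ} {Lσ : ℝ} (hLσ : 0 < Lσ)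
    (hA2 : ∀ x y : ℝ, |σ x - σ y| ≤ Lσ * |x - y|) : LipOn Set.univ σ :=
  ⟨Lσ, hLσ.le, fun x _ y _ => hA2 x y⟩

/-- `σ · G'` is Lipschitz. -/
lemma sigmaD_lip {m : ℕ} (ξ α : Fin m → ℝ) {c : ℝ} (hc : 0 < c) {σ : ℝ → ℝ}
    (hσ : LipOn Set.univ σ) : LipOn Set.univ (fun x => σ x * Dd ξ α c x) := by
  have h : LipOn Set.univ (fun x => σ x + ∑ k, α k * (σ x * p1 c (x - ξ k))) := by
    refine hσ.add (LipOn.sum _ (fun k => LipOn.const_mul (α k) ?_))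
    have hσ' : LipOn (Set.univ ∩ Set.Icc (ξ k - c) (ξ k + c)) σ := hσ.mono (Set.subset_univ _)
    refine LipOn.mul_supp (K := Set.Icc (ξ k - c) (ξ k + c)) hσ'
      (hσ'.bdOn Set.inter_subset_right) ((p1_LB c hc).1.shift _) ((p1_LB c hc).2.shift _) ?_
    intro x hx
    exact p1_zero hc (supp_Icc hx)
  refine h.congr (fun x _ => ?_)
  unfold Dd
  rw [mul_add, mul_one, Finset.mul_sum]
  congr 1
  exact Finset.sum_congr rfl (fun k _ => by ring)

lemma H_lip {m : ℕ} {ξ : Fin m → ℝ} (hξ : StrictMono ξ) (α : Fin m → ℝ) {c : ℝ} (hc : 0 < c)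
    {b σ : ℝ → ℝ} (hσ : LipOn Set.univ σ) (k : Fin (m + 1))
    (hb : ∀ p q : ℝ, LipOn (openItv m ξ k ∩ Set.Icc p q) b) :
    LipOn (openItv m ξ k)
      (fun x => b x * (Dd ξ α c x - 1) + 1 / 2 * σ x ^ 2 * Ss ξ α c x) := by
  have h : LipOn (openItv m ξ k) (fun x => ∑ j, α j * (b x * p1 c (x - ξ j)
      + 1 / 2 * ((σ x * σ x) * p2 c (x - ξ j)))) := by
    refine LipOn.sum _ (fun j => LipOn.const_mul (α j) (LipOn.add ?_ (LipOn.const_mul _ ?_)))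
    · refine LipOn.mul_supp (K := Set.Icc (ξ j - c) (ξ j + c)) (hb _ _)
        ((hb _ _).bdOn Set.inter_subset_right)
        (((p1_LB c hc).1.shift (ξ j)).mono (Set.subset_univ _))
        (((p1_LB c hc).2.shift (ξ j)).mono (Set.subset_univ _)) ?_
      intro x hx
      exact p1_zero hc (supp_Icc hx)
    · have hσ' : LipOn (openItv m ξ k ∩ Set.Icc (ξ j - c) (ξ j + c)) σ :=
        hσ.mono (Set.subset_univ _)
      have hσb := hσ'.bdOn (Set.inter_subset_right)
      have hq : LipOn (openItv m ξ k) (fun x => qq c (x - ξ j)) :=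
        ((qq_LB c hc).1.shift (ξ j)).mono (Set.subset_univ _)
      have hqb : BdOn (openItv m ξ k) (fun x => qq c (x - ξ j)) :=
        ((qq_LB c hc).2.shift (ξ j)).mono (Set.subset_univ _)
      have hq0 : ∀ x, x ∉ Set.Icc (ξ j - c) (ξ j + c) → qq c (x - ξ j) = 0 :=
        fun x hx => qq_zero hc (supp_Icc hx)
      have hmain := LipOn.mul_supp (hσ'.mul hσb hσ' hσb) (hσb.mul hσb) hq hqb hq0
      rcases openItv_side hξ k j with hs | hs
      · refine hmain.congr (fun x hx => ?_)
        have : 0 < x - ξ j := by linarith [hs x hx]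
        simp [p2, sign_pos this]
      · refine (hmain.const_mul (-1)).congr (fun x hx => ?_)
        have : x - ξ j < 0 := by linarith [hs x hx]
        simp [p2, sign_neg this]
  refine h.congr (fun x _ => ?_)
  unfold Dd Ss
  rw [add_sub_cancel_left, Finset.mul_sum, Finset.mul_sum, ← Finset.sum_add_distrib]
  exact Finset.sum_congr rfl (fun k _ => by ring)

lemma LipOn.continuousAt {U : Set ℝ} {f : ℝ → ℝ} (hf : LipOn U f) {x : ℝ} (hx : U ∈ nhds x) :
    ContinuousAt f x := by
  obtain ⟨C, hC, hf⟩ := hf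
  have : LipschitzOnWith (Real.toNNReal C) f U := by
    apply LipschitzOnWith.of_dist_le_mul
    intro x hx y hy
    rw [Real.coe_toNNReal C hC, Real.dist_eq, Real.dist_eq]
    exact hf x hx y hy
  exact this.continuousOn.continuousAt hx

open Classical in
/-- `b` with its values at the exceptional points replaced by the mean of the one-sided limits. -/
noncomputable def b0 {m : ℕ} (ξ : Fin m → ℝ) (b : ℝ → ℝ) (bl br : Fin m → ℝ) (x : ℝ) : ℝ :=
  if h : ∃ k, x = ξ k then (bl h.choose + br h.choose) / 2 else b x

lemma b0_off {m : ℕ} {ξ : Fin m → ℝ} {b : ℝ → ℝ} {bl br : Fin m → ℝ} {x : ℝ}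
    (h : ∀ k, x ≠ ξ k) : b0 ξ b bl br x = b x := by
  unfold b0
  rw [dif_neg]
  push Not
  exact h

lemma b0_on {m : ℕ} {ξ : Fin m → ℝ} (hξ : StrictMono ξ) {b : ℝ → ℝ} {bl br : Fin m → ℝ}
    (k : Fin m) : b0 ξ b bl br (ξ k) = (bl k + br k) / 2 := by
  unfold b0
  have h : ∃ j, ξ k = ξ j := ⟨k, rfl⟩
  rw [dif_pos h]
  have : k = h.choose := hξ.injective h.choose_spec
  rw [← this]

/-- the transformed drift, in the original variable -/
noncomputable def BB {m : ℕ} (ξ α : Fin m → ℝ) (c : ℝ) (b σ : ℝ → ℝ) (bl br : Fin m → ℝ)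
    (x : ℝ) : ℝ :=
  b0 ξ b bl br x * Dd ξ α c x + 1 / 2 * σ x ^ 2 * Ss ξ α c x

lemma BB_continuous {m : ℕ} {ξ : Fin m → ℝ} (hξ : StrictMono ξ) (α : Fin m → ℝ) {c : ℝ}
    (hc : 0 < c) (hsep : ∀ j k : Fin m, j ≠ k → 2 * c < |ξ j - ξ k|)
    {b σ : ℝ → ℝ} (hσ : LipOn Set.univ σ) (hA3 : ∀ k : Fin m, σ (ξ k) ≠ 0)
    (hb : ∀ k : Fin (m + 1), ∀ p q : ℝ, LipOn (openItv m ξ k ∩ Set.Icc p q) b)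
    (bl br : Fin m → ℝ)
    (hbl : ∀ k : Fin m, Filter.Tendsto b (nhdsWithin (ξ k) (Set.Iio (ξ k))) (nhds (bl k)))
    (hbr : ∀ k : Fin m, Filter.Tendsto b (nhdsWithin (ξ k) (Set.Ioi (ξ k))) (nhds (br k)))
    (hα : ∀ k : Fin m, α k = 1 / 2 * (σ (ξ k) ^ 2)⁻¹ * (bl k - br k)) :
    Continuous (BB ξ α c b σ bl br) := by
  rw [continuous_iff_continuousAt]
  intro x
  by_cases hx : ∃ k, x = ξ k
  · obtain ⟨k, rfl⟩ := hx
    have hval : BB ξ α c b σ bl br (ξ k) = (bl k + br k) / 2 := by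
      unfold BB
      rw [b0_on hξ, Dd_single hc hsep k _ (by simpa using hc.le),
        Ss_single hc hsep k _ (by simpa using hc.le)]
      simp [p1, p2]
    have hD1 : Dd ξ α c (ξ k) = 1 := by
      rw [Dd_single hc hsep k _ (by simpa using hc.le)]
      simp [p1]
    have hDt : Filter.Tendsto (Dd ξ α c) (nhds (ξ k)) (nhds 1) := by
      have := (Dd_lip ξ α hc).continuous.tendsto (ξ k)
      rwa [hD1] at this
    have hσt : Filter.Tendsto σ (nhds (ξ k)) (nhds (σ (ξ k))) := hσ.continuous.tendsto (ξ k)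
    have hqt : Filter.Tendsto (fun x => qq c (x - ξ k)) (nhds (ξ k)) (nhds 2) := by
      have := ((qq_LB c hc).1.shift (ξ k)).continuous.tendsto (ξ k)
      have h2 : qq c (ξ k - ξ k) = 2 := by simp [qq, wc]
      rwa [h2] at this
    have hnear : ∀ᶠ x in nhds (ξ k), |x - ξ k| ≤ c := by
      filter_upwards [Metric.ball_mem_nhds (ξ k) hc] with x hx
      rw [Metric.mem_ball, Real.dist_eq] at hx
      exact hx.le
    have hoff : ∀ x, |x - ξ k| ≤ c → x ≠ ξ k → ∀ j, x ≠ ξ j := by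
      intro x hx hne j
      rcases eq_or_ne j k with rfl | hjk
      · exact hne
      · have := far hsep k j hjk x hx
        intro h
        rw [h, sub_self, abs_zero] at this
        linarith
    have hσα : σ (ξ k) ^ 2 * α k = (bl k - br k) / 2 := by
      rw [hα k]
      have := hA3 k
      field_simp
    rw [continuousAt_iff_continuous_left'_right']
    constructor
    · unfold ContinuousWithinAt
      have ht : Filter.Tendsto (fun x => b x * Dd ξ α c x + 1 / 2 * σ x ^ 2 *
          (α k * (-1 * qq c (x - ξ k)))) (nhdsWithin (ξ k) (Set.Iio (ξ k)))
          (nhds (bl k * 1 + 1 / 2 * σ (ξ k) ^ 2 * (α k * (-1 * 2)))) :=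
        ((hbl k).mul (hDt.mono_left nhdsWithin_le_nhds)).add
          ((((hσt.mono_left nhdsWithin_le_nhds).pow 2).const_mul (1 / 2)).mul
            (((hqt.mono_left nhdsWithin_le_nhds).const_mul (-1)).const_mul (α k)))
      have hlim : bl k * 1 + 1 / 2 * σ (ξ k) ^ 2 * (α k * (-1 * 2))
          = BB ξ α c b σ bl br (ξ k) := by rw [hval]; linarith
      rw [hlim] at ht
      refine ht.congr' ?_
      filter_upwards [mem_nhdsWithin_of_mem_nhds hnear, self_mem_nhdsWithin] with x hx1 hx2
      have hx2' : x < ξ k := hx2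
      unfold BB
      rw [b0_off (hoff x hx1 hx2'.ne), Ss_single hc hsep k x hx1, p2,
        sign_neg (by linarith : x - ξ k < 0)]
      simp
    · unfold ContinuousWithinAt
      have ht : Filter.Tendsto (fun x => b x * Dd ξ α c x + 1 / 2 * σ x ^ 2 *
          (α k * (1 * qq c (x - ξ k)))) (nhdsWithin (ξ k) (Set.Ioi (ξ k)))
          (nhds (br k * 1 + 1 / 2 * σ (ξ k) ^ 2 * (α k * (1 * 2)))) :=
        ((hbr k).mul (hDt.mono_left nhdsWithin_le_nhds)).add
          ((((hσt.mono_left nhdsWithin_le_nhds).pow 2).const_mul (1 / 2)).mul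
            (((hqt.mono_left nhdsWithin_le_nhds).const_mul (1)).const_mul (α k)))
      have hlim : br k * 1 + 1 / 2 * σ (ξ k) ^ 2 * (α k * (1 * 2))
          = BB ξ α c b σ bl br (ξ k) := by rw [hval]; linarith
      rw [hlim] at ht
      refine ht.congr' ?_
      filter_upwards [mem_nhdsWithin_of_mem_nhds hnear, self_mem_nhdsWithin] with x hx1 hx2
      have hx2' : ξ k < x := hx2
      unfold BB
      rw [b0_off (hoff x hx1 hx2'.ne'), Ss_single hc hsep k x hx1, p2,
        sign_pos (by linarith : 0 < x - ξ k)]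
      simp
  · push Not at hx
    obtain ⟨k, hk, -⟩ := exists_openItv hξ x x le_rfl
      (fun j hj => hx j (le_antisymm hj.1 hj.2))
    have hU : openItv m ξ k ∈ nhds x := (isOpen_openItv m ξ k).mem_nhds hk
    have h1 : ContinuousAt b x := (hb k (x - 1) (x + 1)).continuousAt
      (Filter.inter_mem hU (Icc_mem_nhds (by linarith) (by linarith)))
    have h2 := (H_lip hξ α hc hσ k (hb k)).continuousAt hU
    refine (h1.add h2).congr ?_
    filter_upwards [hU] with y hy
    have hoff : ∀ j, y ≠ ξ j := by
      intro j
      rcases openItv_side hξ k j with h | h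
      · exact (h y hy).ne'
      · exact (h y hy).ne
    unfold BB
    rw [b0_off hoff, Pi.add_apply]
    ring

/-- regularity of the coefficients `(b̃, σ̃)` of the transformed SDE.  Under
Assumption (A) on `(b, σ)` — condition (A1) for `b` on each interval `(ξ_k, ξ_{k+1})`,
`σ` globally Lipschitz, `σ(ξ_k) ≠ 0` — with `α_k = σ(ξ_k)⁻²·(b(ξ_k-) - b(ξ_k+))/2` and
`G(x) = x + Σ_k α_k·φ((x-ξ_k)/c₀)·(x-ξ_k)·|x-ξ_k|`, there are constants
`L_b̃, K_b̃, L_σ̃, γ̃, η̃ ∈ (0,∞)` and a continuous `b̃` with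
`b̃(G(x)) = b(x)·G′(x) + σ(x)²·G″(x)/2` off `{ξ₁,…,ξ_m}` such that, with
`σ̃ = (σ·G′)∘G⁻¹`: (i) `b̃` is absolutely continuous on `ℝ`; (ii) `b̃` is one-sided
Lipschitz; (iii) `b̃` is locally Lipschitz with exponential growth; (iv) `σ̃` is globally
Lipschitz; (v) `(b̃, σ̃)` satisfy the monotonicity condition
`max (z·b̃(z)) (σ̃(z)²) ≤ α + β·z²`. -/
theorem stmt_10 (m : ℕ) (ξ : Fin m → ℝ) (hξ : StrictMono ξ)
    (Lb Kb Lσ γ η : ℝ) (hLb : 0 < Lb) (hKb : 0 < Kb) (hLσ : 0 < Lσ) (hγ : 0 < γ) (hη : 0 < η)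
    (b σ : ℝ → ℝ) (hσnn : ∀ x : ℝ, 0 ≤ σ x)
    (hA1 : ∀ k : Fin (m + 1), CondA1 b (openItv m ξ k) Lb Kb γ η)
    (hA2 : ∀ x y : ℝ, |σ x - σ y| ≤ Lσ * |x - y|)
    (hA3 : ∀ k : Fin m, σ (ξ k) ≠ 0)
    (bl br : Fin m → ℝ)
    (hbl : ∀ k : Fin m, Filter.Tendsto b (nhdsWithin (ξ k) (Set.Iio (ξ k))) (nhds (bl k)))
    (hbr : ∀ k : Fin m, Filter.Tendsto b (nhdsWithin (ξ k) (Set.Ioi (ξ k))) (nhds (br k)))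
    (α : Fin m → ℝ) (hα : ∀ k : Fin m, α k = 1 / 2 * (σ (ξ k) ^ 2)⁻¹ * (bl k - br k))
    (c₀ : ℝ) (hc₀ : 0 < c₀) (hc₁ : ∀ k : Fin m, 6 * c₀ * |α k| < 1)
    (hc₂ : ∀ (k : ℕ) (hk : k + 1 < m), 2 * c₀ < ξ ⟨k + 1, hk⟩ - ξ ⟨k, by omega⟩)
    (G : ℝ → ℝ) (hG : ∀ x : ℝ, G x = x + ∑ k : Fin m, α k * phibar (ξ k) c₀ x) :
    ∃ Lbt Kbt Lσt γt ηt : ℝ,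
      0 < Lbt ∧ 0 < Kbt ∧ 0 < Lσt ∧ 0 < γt ∧ 0 < ηt ∧
      ∃ btilde : ℝ → ℝ, Continuous btilde ∧
        (∀ x : ℝ, (∀ k : Fin m, x ≠ ξ k) →
          btilde (G x) = b x * deriv G x + 1 / 2 * σ x ^ 2 * deriv (deriv G) x) ∧
        AbsContOn btilde Set.univ ∧
        (∀ z w : ℝ, (z - w) * (btilde z - btilde w) ≤ Lbt * |z - w| ^ 2) ∧
        (∀ z₀ z₁ : ℝ, |btilde z₀ - btilde z₁| ≤
          Kbt * (Real.exp (γt * |z₀| ^ ηt) + Real.exp (γt * |z₁| ^ ηt)) * |z₀ - z₁|) ∧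
        (∀ z w : ℝ,
          |σ (Function.invFun G z) * deriv G (Function.invFun G z) -
            σ (Function.invFun G w) * deriv G (Function.invFun G w)| ≤ Lσt * |z - w|) ∧
        (∃ a β : ℝ, 0 < a ∧ 0 < β ∧ ∀ z : ℝ,
          max (z * btilde z)
              ((σ (Function.invFun G z) * deriv G (Function.invFun G z)) ^ 2)
            ≤ a + β * z ^ 2) := by
  have hsep := sep hξ (fun k hk _ => hc₂ k hk)
  have hσl : LipOn Set.univ σ := sigma_lip hLσ hA2
  have hb : ∀ k : Fin (m + 1), ∀ p q : ℝ, LipOn (openItv m ξ k ∩ Set.Icc p q) b :=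
    fun k p q => b_lip hKb hγ hη (hA1 k).2.2 p q
  have hdG : ∀ x, HasDerivAt G (Dd ξ α c₀ x) x := hasDerivAt_G ξ α hc₀ G hG
  have hderiv : deriv G = Dd ξ α c₀ := funext (fun x => (hdG x).deriv)
  obtain ⟨δ, hδ, hDδ⟩ := Dd_lower (α := α) hc₀ hsep hc₁
  have hGdiff : Differentiable ℝ G := fun x => (hdG x).differentiableAt
  have hGmono : ∀ x y, x ≤ y → δ * (y - x) ≤ G y - G x := by
    intro x y hxy
    exact mul_sub_le_image_sub_of_le_deriv hGdiff (fun x => by rw [hderiv]; exact hDδ x) hxy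
  have hBc := BB_continuous hξ α hc₀ hsep hσl hA3 hb bl br hbl hbr hα
  -- uniform Lipschitz constant of the correction
  choose C hC0 hC using fun k => H_lip hξ α hc₀ hσl k (hb k)
  set Ct := ∑ k, C k with hCt
  have hCt0 : 0 ≤ Ct := Finset.sum_nonneg (fun k _ => hC0 k)
  have hCle : ∀ k, C k ≤ Ct := fun k =>
    Finset.single_le_sum (fun i _ => hC0 i) (Finset.mem_univ k)
  have hBeq : ∀ k, ∀ x ∈ openItv m ξ k, BB ξ α c₀ b σ bl br x =
      b x + (b x * (Dd ξ α c₀ x - 1) + 1 / 2 * σ x ^ 2 * Ss ξ α c₀ x) := by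
    intro k x hx
    have hoff : ∀ j, x ≠ ξ j := by
      intro j
      rcases openItv_side hξ k j with h | h
      · exact (h x hx).ne'
      · exact (h x hx).ne
    unfold BB
    rw [b0_off hoff]
    ring
  set S : Finset ℝ := Finset.univ.image ξ with hS
  have hpiece : ∀ x y, x < y → (∀ s ∈ S, ¬ (x ≤ s ∧ s ≤ y)) →
      ∃ k, x ∈ openItv m ξ k ∧ y ∈ openItv m ξ k := by
    intro x y hxy hs
    exact exists_openItv hξ x y hxy.le
      (fun j => hs (ξ j) (Finset.mem_image_of_mem _ (Finset.mem_univ j)))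
  have hone : ∀ x y, x ≤ y →
      BB ξ α c₀ b σ bl br y - BB ξ α c₀ b σ bl br x ≤ (Lb + Ct) * (y - x) := by
    intro x y hxy
    apply glue' S _ hBc _ x y hxy
    intro u v _ huv _ hs
    obtain ⟨k, hu, hv⟩ := hpiece u v huv hs
    rw [hBeq k u hu, hBeq k v hv]
    have h1 := (hA1 k).2.1 v hv u hu
    have h2 := (le_abs_self _).trans (hC k v hv u hu)
    have hpos : 0 < v - u := by linarith
    rw [abs_of_pos hpos] at h1 h2
    have h3 : b v - b u ≤ Lb * (v - u) := by
      have : (v - u) * (b v - b u) ≤ (v - u) * (Lb * (v - u)) := by linarith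
      exact le_of_mul_le_mul_left this hpos
    have h4 := mul_le_mul_of_nonneg_right (hCle k) hpos.le
    linarith
  have hE1 : ∀ x : ℝ, 1 ≤ Real.exp (γ * |x| ^ η) := by
    intro x
    apply Real.one_le_exp
    have := Real.rpow_nonneg (abs_nonneg x) η
    positivity
  have hgrow' : ∀ x y, x ≤ y →
      |BB ξ α c₀ b σ bl br x - BB ξ α c₀ b σ bl br y| ≤
      (2 * (Kb + Ct)) * (Real.exp (γ * |x| ^ η) + Real.exp (γ * |y| ^ η)) * |x - y| := by
    intro x y hxy
    set E := Real.exp (γ * |x| ^ η) + Real.exp (γ * |y| ^ η) with hE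
    have hbd : ∀ u, x < u → u < y → Real.exp (γ * |u| ^ η) ≤ E := by
      intro u hxu huy
      have hmax : |u| ≤ max |x| |y| := abs_le_max_abs_abs hxu.le huy.le
      rcases le_max_iff.1 hmax with h | h
      · have : Real.exp (γ * |u| ^ η) ≤ Real.exp (γ * |x| ^ η) :=
          Real.exp_le_exp.2 (mul_le_mul_of_nonneg_left
            (Real.rpow_le_rpow (abs_nonneg _) h hη.le) hγ.le)
        linarith [hE1 y]
      · have : Real.exp (γ * |u| ^ η) ≤ Real.exp (γ * |y| ^ η) :=
          Real.exp_le_exp.2 (mul_le_mul_of_nonneg_left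
            (Real.rpow_le_rpow (abs_nonneg _) h hη.le) hγ.le)
        linarith [hE1 x]
    have hloc : ∀ u v, x < u → u < v → v < y → (∀ s ∈ S, ¬ (u ≤ s ∧ s ≤ v)) →
        |BB ξ α c₀ b σ bl br v - BB ξ α c₀ b σ bl br u| ≤ (2 * (Kb + Ct)) * E * (v - u) := by
      intro u v hxu huv hvy hs
      obtain ⟨k, hu, hv⟩ := hpiece u v huv hs
      rw [hBeq k u hu, hBeq k v hv]
      have h1 := (hA1 k).2.2 v hv u hu
      have h2 := hC k v hv u hu
      have hpos : 0 < v - u := by linarith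
      rw [abs_of_pos hpos] at h1 h2
      have h4 := mul_le_mul_of_nonneg_right (hCle k) hpos.le
      have h5 : Kb * (Real.exp (γ * |v| ^ η) + Real.exp (γ * |u| ^ η)) * (v - u)
          ≤ Kb * (E + E) * (v - u) :=
        mul_le_mul_of_nonneg_right (mul_le_mul_of_nonneg_left
          (add_le_add (hbd v (by linarith) hvy) (hbd u hxu (by linarith))) hKb.le) hpos.le
      have h6 : Ct * (v - u) ≤ Ct * (v - u) * (2 * E) :=
        le_mul_of_one_le_right (by positivity) (by linarith [hE1 x, hE1 y])
      rw [add_sub_add_comm]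
      refine (abs_add_le _ _).trans ?_
      nlinarith
    have g1 := glue' S _ hBc ((2 * (Kb + Ct)) * E) x y hxy (fun u v hu huv hv hs =>
      (le_abs_self _).trans (hloc u v hu huv hv hs))
    have g2 := glue' S (fun x => - BB ξ α c₀ b σ bl br x) hBc.neg ((2 * (Kb + Ct)) * E) x y hxy
      (fun u v hu huv hv hs => by
        have := (neg_abs_le _).trans (le_refl _) |>.trans' (neg_le_neg (hloc u v hu huv hv hs))
        linarith)
    have hyx : |x - y| = y - x := by rw [abs_sub_comm, abs_of_nonneg (by linarith)]
    rw [hyx, abs_le]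
    constructor <;> linarith
  have hgrow : ∀ x y, |BB ξ α c₀ b σ bl br x - BB ξ α c₀ b σ bl br y| ≤
      (2 * (Kb + Ct)) * (Real.exp (γ * |x| ^ η) + Real.exp (γ * |y| ^ η)) * |x - y| := by
    intro x y
    rcases le_total x y with h | h
    · exact hgrow' x y h
    · have := hgrow' y x h
      rw [abs_sub_comm, abs_sub_comm x y, add_comm (Real.exp (γ * |x| ^ η))]
      exact this
  obtain ⟨Lbt, Kbt, γt, ηt, hL, hK, hg, he, hcont, hac, hos, hgr⟩ :=
    transfer G (BB ξ α c₀ b σ bl br) hGdiff.continuous hBc δ hδ hGmono (Lb + Ct)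
      (2 * (Kb + Ct)) γ η (by positivity) (by positivity) hγ hη hone hgrow
  obtain ⟨hl, hr, hm, hlip⟩ := invFun_facts G hGdiff.continuous δ hδ hGmono
  obtain ⟨Cs, hCs0, hCs⟩ := sigmaD_lip ξ α hc₀ hσl
  set F := Function.invFun G with hF
  have hsig : ∀ z w : ℝ, |σ (F z) * deriv G (F z) - σ (F w) * deriv G (F w)|
      ≤ ((Cs + 1) * (1 / δ)) * |z - w| := by
    intro z w
    rw [hderiv]
    refine (hCs (F z) trivial (F w) trivial).trans ?_
    rw [mul_assoc]
    exact mul_le_mul (by linarith) (hlip z w) (abs_nonneg _) (by positivity)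
  have hLs : 0 < (Cs + 1) * (1 / δ) := by positivity
  set Ls := (Cs + 1) * (1 / δ) with hLsdef
  refine ⟨Lbt, Kbt, Ls, γt, ηt, hL, hK, hLs, hg, he, fun z => BB ξ α c₀ b σ bl br (F z), hcont,
    ?_, hac, hos, hgr, hsig, ?_⟩
  · intro x hx
    change BB ξ α c₀ b σ bl br (F (G x)) = _
    rw [hl, hderiv, (hasDerivAt_Dd ξ α hc₀ x hx).deriv]
    unfold BB
    rw [b0_off hx]
  · set B0 := BB ξ α c₀ b σ bl br (F 0) with hB0
    set s0 := σ (F 0) * deriv G (F 0) with hs0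
    refine ⟨B0 ^ 2 + 2 * s0 ^ 2 + 1, Lbt + 1 + 2 * Ls ^ 2, by positivity, by positivity,
      fun z => ?_⟩
    have p1 : 0 ≤ B0 ^ 2 := sq_nonneg _
    have p2 : 0 ≤ s0 ^ 2 := sq_nonneg _
    have p3 : 0 ≤ z ^ 2 := sq_nonneg _
    have p4 : 0 ≤ Ls ^ 2 * z ^ 2 := by positivity
    have p5 : 0 ≤ Lbt * z ^ 2 := by positivity
    apply max_le
    · have h1 := hos z 0
      rw [sub_zero, sq_abs] at h1
      change z * BB ξ α c₀ b σ bl br (F z) ≤ _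
      nlinarith [sq_nonneg (z - B0)]
    · have h1 := hsig z 0
      rw [sub_zero] at h1
      set s := σ (F z) * deriv G (F z)
      have h2 : (s - s0) ^ 2 ≤ (Ls * |z|) ^ 2 := by
        rw [← sq_abs (s - s0)]
        exact pow_le_pow_left₀ (abs_nonneg _) h1 2
      rw [mul_pow, sq_abs] at h2
      nlinarith [sq_nonneg (s - 2 * s0)]
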